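/- arXiv:1805.00982 — 2 statements merged into one kernel-verified Lean document; each statement's English description precedes it below -/
import Mathlib

section
/- (Lemma 1.) Assume ημ ≤ 1 and η ≤ 1/(2L). Let S_ℓ = Σ_{t=0}^{ℓ−1} (1 − ημ)^t and, for each tuple ω, let x̃(ω) = (1/S_ℓ)·Σ_{t=0}^{ℓ−1} (1 − ημ)^{ℓ−1−t}·x_t(ω). Then E_ω ‖x_ℓ(ω) − x*‖² ≤ (1 − ημ)^ℓ·‖x_0 − x*‖² − 2η(1 − 2Lη)·S_ℓ·E_ω[f(x̃(ω)) − f(x*)] + 2η²·S_ℓ·(1/n)·Σ_{i=1}^n ‖α_i − ∇f_i(x*)‖². -/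
open RealInnerProductSpace

theorem HasGradientAt.hasDerivAt_line {E : Type*} [NormedAddCommGroup E] [InnerProductSpace ℝ E]
    [CompleteSpace E] {f : E → ℝ} {v x d : E} {t : ℝ} (h : HasGradientAt f v (x + t • d)) :
    HasDerivAt (fun s : ℝ => f (x + s • d)) ⟪v, d⟫ t := by
  have h2 : HasDerivAt (fun s : ℝ => x + s • d) d t := by
    simpa using ((hasDerivAt_id t).smul_const d).const_add x
  have h3 := h.hasFDerivAt.comp_hasDerivAt t h2
  exact h3.congr_deriv (InnerProductSpace.toDual_apply_apply ..)

/-- First-order lower bound for a differentiable convex function. -/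
theorem ConvexOn.add_inner_gradient_le {E : Type*} [NormedAddCommGroup E] [InnerProductSpace ℝ E]
    [CompleteSpace E] {f : E → ℝ} {v x : E} (hf : ConvexOn ℝ Set.univ f)
    (h : HasGradientAt f v x) (y : E) : f x + ⟪v, y - x⟫ ≤ f y := by
  have hline : ConvexOn ℝ Set.univ (fun s : ℝ => f (x + s • (y - x))) := by
    refine ⟨convex_univ, fun a _ b _ p q hp hq hpq => ?_⟩
    have := hf.2 (Set.mem_univ (x + a • (y - x))) (Set.mem_univ (x + b • (y - x))) hp hq hpq
    convert this using 2
    obtain rfl : q = 1 - p := by linarith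
    simp only [smul_eq_mul]
    module
  have hd : HasDerivAt (fun s : ℝ => f (x + s • (y - x))) ⟪v, y - x⟫ 0 :=
    HasGradientAt.hasDerivAt_line (by simpa using h)
  have := hline.le_slope_of_hasDerivAt (Set.mem_univ 0) (Set.mem_univ 1) one_pos hd
  simp [slope_def_field] at this
  linarith

/-- The descent lemma for a function with Lipschitz gradient. -/
theorem le_add_inner_gradient_add_sq {E : Type*} [NormedAddCommGroup E] [InnerProductSpace ℝ E]
    [CompleteSpace E] {f : E → ℝ} {g : E → E} {L : ℝ} (hgrad : ∀ x, HasGradientAt f (g x) x)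
    (hsmooth : ∀ x y, ‖g x - g y‖ ≤ L * ‖x - y‖) (x y : E) :
    f y ≤ f x + ⟪g x, y - x⟫ + L / 2 * ‖y - x‖ ^ 2 := by
  set d := y - x with hd
  let φ : ℝ → ℝ := fun s => f (x + s • d) - (s * ⟪g x, d⟫ + L / 2 * ‖d‖ ^ 2 * s ^ 2)
  have hφ : ∀ t : ℝ, HasDerivAt φ
      (⟪g (x + t • d), d⟫ - (⟪g x, d⟫ + L * ‖d‖ ^ 2 * t)) t := by
    intro t
    have h1 := ((hasDerivAt_id t).mul_const ⟪g x, d⟫).add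
      (((hasDerivAt_id t).pow 2).const_mul (L / 2 * ‖d‖ ^ 2))
    refine ((hgrad (x + t • d)).hasDerivAt_line.sub h1).congr_deriv ?_
    simp
    ring
  have hanti : AntitoneOn φ (Set.Ici 0) := by
    refine antitoneOn_of_deriv_nonpos (convex_Ici 0)
      (fun t _ => (hφ t).continuousAt.continuousWithinAt)
      (fun t _ => (hφ t).differentiableAt.differentiableWithinAt) fun t ht => ?_
    rw [interior_Ici, Set.mem_Ioi] at ht
    rw [(hφ t).deriv]
    have h1 : ⟪g (x + t • d) - g x, d⟫ ≤ ‖g (x + t • d) - g x‖ * ‖d‖ := real_inner_le_norm _ _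
    have h2 := hsmooth (x + t • d) x
    rw [add_sub_cancel_left, norm_smul, Real.norm_of_nonneg ht.le] at h2
    rw [inner_sub_left] at h1
    nlinarith [mul_le_mul_of_nonneg_right h2 (norm_nonneg d)]
  have h := hanti (Set.mem_Ici.2 le_rfl) (Set.mem_Ici.2 zero_le_one) zero_le_one
  simp only [φ, zero_smul, one_smul, add_zero, hd, add_sub_cancel] at h
  rw [hd]
  linarith

/-- Cocoercivity: the gradient gap of a smooth convex function is bounded by its Bregman gap. -/
theorem ConvexOn.norm_gradient_sub_sq_le {E : Type*} [NormedAddCommGroup E]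
    [InnerProductSpace ℝ E] [CompleteSpace E] {f : E → ℝ} {g : E → E} {L : ℝ} (hL : 0 < L)
    (hf : ConvexOn ℝ Set.univ f) (hgrad : ∀ x, HasGradientAt f (g x) x)
    (hsmooth : ∀ x y, ‖g x - g y‖ ≤ L * ‖x - y‖) (x y : E) :
    ‖g x - g y‖ ^ 2 ≤ 2 * L * (f x - f y - ⟪g y, x - y⟫) := by
  set w := g x - g y with hw
  have h1 := le_add_inner_gradient_add_sq hgrad hsmooth x (x - (1 / L) • w)
  have h2 := hf.add_inner_gradient_le (hgrad y) (x - (1 / L) • w)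
  have e1 : x - (1 / L) • w - x = -((1 / L) • w) := by abel
  have e2 : x - (1 / L) • w - y = (x - y) - (1 / L) • w := by abel
  have e3 : ⟪g x, w⟫ - ⟪g y, w⟫ = ‖w‖ ^ 2 := by
    rw [← inner_sub_left, ← hw, real_inner_self_eq_norm_sq]
  rw [e1, inner_neg_right, norm_neg, norm_smul, inner_smul_right, mul_pow, Real.norm_eq_abs,
    sq_abs] at h1
  rw [e2, inner_sub_right, inner_smul_right] at h2
  have h3 : 1 / L * ‖w‖ ^ 2 - L / 2 * ((1 / L) ^ 2 * ‖w‖ ^ 2) ≤ f x - f y - ⟪g y, x - y⟫ := by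
    rw [← e3, mul_sub, e3]
    linarith
  have h4 : 1 / L * ‖w‖ ^ 2 - L / 2 * ((1 / L) ^ 2 * ‖w‖ ^ 2) = ‖w‖ ^ 2 / (2 * L) := by
    field_simp
    ring
  rw [h4, div_le_iff₀ (by positivity)] at h3
  linarith

/-- The second moment of a centred family is at most its raw second moment. -/
theorem sum_norm_sub_mean_sq_le {ι E : Type*} [Fintype ι] [NormedAddCommGroup E]
    [InnerProductSpace ℝ E] (a : ι → E) (m : E) (hm : (Fintype.card ι : ℝ) • m = ∑ i, a i) :
    ∑ i, ‖a i - m‖ ^ 2 ≤ ∑ i, ‖a i‖ ^ 2 := by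
  have h : ∑ i, ⟪a i, m⟫ = Fintype.card ι * ‖m‖ ^ 2 := by
    rw [← sum_inner, ← hm, real_inner_smul_left, real_inner_self_eq_norm_sq]
  simp only [norm_sub_sq_real, Finset.sum_add_distrib, Finset.sum_sub_distrib, ← Finset.mul_sum, h,
    Finset.sum_const, Finset.card_univ, nsmul_eq_mul]
  have : 0 ≤ (Fintype.card ι : ℝ) * ‖m‖ ^ 2 := by positivity
  linarith

/-- If `H · i` does not depend on coordinate `t`, then that coordinate may be averaged
independently of the others. -/
theorem Fintype.card_mul_sum_apply_eq {ι κ : Type*} [Fintype ι] [DecidableEq ι] [Fintype κ]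
    (t : ι) (H : (ι → κ) → κ → ℝ) (hH : ∀ ω i j, H (Function.update ω t j) i = H ω i) :
    (Fintype.card κ : ℝ) * ∑ ω, H ω (ω t) = ∑ ω, ∑ i, H ω i := by
  have hinv : Function.Involutive
      (fun p : (ι → κ) × κ => (Function.update p.1 t p.2, p.1 t)) := fun p => by simp
  have h := Equiv.sum_comp hinv.toPerm (fun p : (ι → κ) × κ => H p.1 (p.1 t))
  simp only [Function.Involutive.coe_toPerm, Function.update_self, hH, Fintype.sum_prod_type,
    Finset.sum_const, Finset.card_univ, nsmul_eq_mul, ← Finset.mul_sum] at h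
  exact h.symm

/-- One step of variance-reduced stochastic gradient descent, averaged over the sampled index. -/
theorem sum_norm_svrg_step_sq_le {E : Type*} [NormedAddCommGroup E]
    [InnerProductSpace ℝ E] [CompleteSpace E]
    {n : ℕ} (hn : 0 < n) {L μ : ℝ} (hL : 0 < L)
    {f : Fin n → E → ℝ} {g : Fin n → E → E}
    (hgrad : ∀ i x, HasGradientAt (f i) (g i x) x)
    (hconv : ∀ i, ConvexOn ℝ Set.univ (f i))
    (hsmooth : ∀ i x y, ‖g i x - g i y‖ ≤ L * ‖x - y‖)
    {F : E → ℝ} (hF : ∀ x, F x = (1 / (n : ℝ)) * ∑ i, f i x)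
    {G : E → E} (hG : ∀ x, G x = (1 / (n : ℝ)) • ∑ i, g i x)
    (hstrong : ∀ x y, F y ≥ F x + ⟪G x, y - x⟫ + (μ / 2) * ‖y - x‖ ^ 2)
    {xstar : E} (hmin : ∀ y, F xstar ≤ F y)
    {α : Fin n → E} {αbar : E} (hαbar : αbar = (1 / (n : ℝ)) • ∑ i, α i)
    {η : ℝ} (hη : 0 < η) (x : E) :
    ∑ i, ‖x - η • (g i x - α i + αbar) - xstar‖ ^ 2 ≤
      n * ((1 - η * μ) * ‖x - xstar‖ ^ 2 - 2 * η * (1 - 2 * L * η) * (F x - F xstar)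
        + 2 * η ^ 2 * ((1 / (n : ℝ)) * ∑ i, ‖α i - g i xstar‖ ^ 2)) := by
  have hn0 : (n : ℝ) ≠ 0 := by positivity
  have hnF : ∀ z, ∑ i, f i z = n * F z := fun z => by rw [hF]; field_simp
  have hnG : ∀ z, ∑ i, g i z = (n : ℝ) • G z := fun z => by
    rw [hG, smul_smul, mul_one_div_cancel hn0, one_smul]
  have hnα : ∑ i, α i = (n : ℝ) • αbar := by
    rw [hαbar, smul_smul, mul_one_div_cancel hn0, one_smul]
  have hGstar : G xstar = 0 := by
    have hd : HasFDerivAt F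
        ((1 / (n : ℝ)) • ∑ i, (InnerProductSpace.toDual ℝ E (g i xstar))) xstar := by
      have h := (HasFDerivAt.fun_sum (u := Finset.univ)
        fun i _ => (hgrad i xstar).hasFDerivAt).const_mul (1 / (n : ℝ))
      rwa [← funext hF] at h
    have hloc : IsLocalMin F xstar := Filter.Eventually.of_forall hmin
    have h0 := hloc.hasFDerivAt_eq_zero hd
    apply (InnerProductSpace.toDual ℝ E).injective
    rw [hG, map_smulₛₗ, map_sum, map_zero]
    simpa only [conj_trivial] using h0
  have hcoc : ∑ i, ‖g i x - g i xstar‖ ^ 2 ≤ n * (2 * L * (F x - F xstar)) := by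
    refine (Finset.sum_le_sum fun i _ =>
      (hconv i).norm_gradient_sub_sq_le hL (hgrad i) (hsmooth i) x xstar).trans_eq ?_
    rw [← Finset.mul_sum, Finset.sum_sub_distrib, Finset.sum_sub_distrib, hnF, hnF, ← sum_inner,
      hnG, hGstar, smul_zero, inner_zero_left]
    ring
  have hvar : ∑ i, ‖α i - g i xstar - αbar‖ ^ 2 ≤ ∑ i, ‖α i - g i xstar‖ ^ 2 := by
    apply sum_norm_sub_mean_sq_le
    rw [Finset.sum_sub_distrib, hnG, hGstar, hnα, smul_zero, sub_zero, Fintype.card_fin]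
  have hv : ∑ i, ‖g i x - α i + αbar‖ ^ 2 ≤
      2 * (n * (2 * L * (F x - F xstar))) + 2 * ∑ i, ‖α i - g i xstar‖ ^ 2 := by
    have h : ∀ i, ‖g i x - α i + αbar‖ ^ 2 ≤
        2 * ‖g i x - g i xstar‖ ^ 2 + 2 * ‖α i - g i xstar - αbar‖ ^ 2 := fun i => by
      have e : g i x - α i + αbar = (g i x - g i xstar) - (α i - g i xstar - αbar) := by abel
      have p := parallelogram_law_with_norm ℝ (g i x - g i xstar) (α i - g i xstar - αbar)
      rw [e]
      nlinarith [sq_nonneg ‖(g i x - g i xstar) + (α i - g i xstar - αbar)‖]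
    refine (Finset.sum_le_sum fun i _ => h i).trans ?_
    rw [Finset.sum_add_distrib, ← Finset.mul_sum, ← Finset.mul_sum]
    linarith
  have hsum : ∑ i, (g i x - α i + αbar) = (n : ℝ) • G x := by
    rw [Finset.sum_add_distrib, Finset.sum_sub_distrib, hnG, hnα, Finset.sum_const,
      Finset.card_univ, Fintype.card_fin, ← Nat.cast_smul_eq_nsmul ℝ]
    abel
  have hexp : ∑ i, ‖x - η • (g i x - α i + αbar) - xstar‖ ^ 2 =
      n * ‖x - xstar‖ ^ 2 - 2 * η * (n * ⟪G x, x - xstar⟫)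
        + η ^ 2 * ∑ i, ‖g i x - α i + αbar‖ ^ 2 := by
    rw [← real_inner_smul_left, ← hsum, sum_inner, Finset.mul_sum, Finset.mul_sum]
    have : (n : ℝ) * ‖x - xstar‖ ^ 2 = ∑ _i : Fin n, ‖x - xstar‖ ^ 2 := by simp
    rw [this, ← Finset.sum_sub_distrib, ← Finset.sum_add_distrib]
    refine Finset.sum_congr rfl fun i _ => ?_
    rw [sub_right_comm, norm_sub_sq_real, inner_smul_right, norm_smul, mul_pow, Real.norm_eq_abs,
      sq_abs, real_inner_comm]
    ring
  have hs := hstrong x xstar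
  rw [← neg_sub x xstar, inner_neg_right, norm_neg] at hs
  have hs' : (n * (2 * η)) * (F x - F xstar + μ / 2 * ‖x - xstar‖ ^ 2) ≤
      (n * (2 * η)) * ⟪G x, x - xstar⟫ :=
    mul_le_mul_of_nonneg_left (by linarith) (by positivity)
  have hv' := mul_le_mul_of_nonneg_left hv (sq_nonneg η)
  have hA : (n : ℝ) * (2 * η ^ 2 * ((1 / (n : ℝ)) * ∑ i, ‖α i - g i xstar‖ ^ 2)) =
      2 * η ^ 2 * ∑ i, ‖α i - g i xstar‖ ^ 2 := by field_simp
  rw [hexp, mul_add, hA]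
  linarith

/-- Unrolling a linear recursive inequality. -/
theorem le_pow_mul_add_sum_of_recurrence {q : ℝ} (hq : 0 ≤ q) {u b : ℕ → ℝ} {l : ℕ}
    (h : ∀ t < l, u (t + 1) ≤ q * u t + b t) :
    u l ≤ q ^ l * u 0 + ∑ t ∈ Finset.range l, q ^ (l - 1 - t) * b t := by
  induction l with
  | zero => simp
  | succ l ih =>
    have h1 := mul_le_mul_of_nonneg_left (ih fun t ht => h t (ht.trans l.lt_succ_self)) hq
    have h2 : ∑ t ∈ Finset.range l, q ^ (l + 1 - 1 - t) * b t =
        q * ∑ t ∈ Finset.range l, q ^ (l - 1 - t) * b t := by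
      rw [Finset.mul_sum]
      refine Finset.sum_congr rfl fun t ht => ?_
      have := Finset.mem_range.1 ht
      rw [← mul_assoc, ← pow_succ']
      congr 2
      omega
    have h3 := h l l.lt_succ_self
    rw [Finset.sum_range_succ, h2, pow_succ']
    simp only [add_tsub_cancel_right, tsub_self, pow_zero, one_mul]
    linarith

/-- Lemma 1: recurrence over one inner loop of `k`-SVRG, in tuple-average form. -/
theorem kSVRG_inner_loop_recurrence {E : Type*} [NormedAddCommGroup E]
    [InnerProductSpace ℝ E] [CompleteSpace E]
    (n : ℕ) (hn : 0 < n) (L μ : ℝ) (hL : 0 < L) (hμ : 0 < μ)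
    (f : Fin n → E → ℝ) (g : Fin n → E → E)
    (hgrad : ∀ i x, HasGradientAt (f i) (g i x) x)
    (hconv : ∀ i, ConvexOn ℝ Set.univ (f i))
    (hsmooth : ∀ i x y, ‖g i x - g i y‖ ≤ L * ‖x - y‖)
    (F : E → ℝ) (hF : ∀ x, F x = (1 / (n : ℝ)) * ∑ i, f i x)
    (G : E → E) (hG : ∀ x, G x = (1 / (n : ℝ)) • ∑ i, g i x)
    (hstrong : ∀ x y, F y ≥ F x + ⟪G x, y - x⟫ + (μ / 2) * ‖y - x‖ ^ 2)
    (xstar : E) (hmin : ∀ y, F xstar ≤ F y)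
    (α : Fin n → E) (αbar : E) (hαbar : αbar = (1 / (n : ℝ)) • ∑ i, α i)
    (η : ℝ) (hη : 0 < η) (hημ : η * μ ≤ 1) (hηL : η ≤ 1 / (2 * L))
    (l : ℕ) (hl : 0 < l)
    (x0 : E) (X : (Fin l → Fin n) → ℕ → E)
    (hX0 : ∀ ω, X ω 0 = x0)
    (hXstep : ∀ ω (t : Fin l),
      X ω (t.val + 1) = X ω t.val - η • (g (ω t) (X ω t.val) - α (ω t) + αbar))
    (S : ℝ) (hS : S = ∑ t ∈ Finset.range l, (1 - η * μ) ^ t)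
    (xt : (Fin l → Fin n) → E)
    (hxt : ∀ ω, xt ω =
      (1 / S) • ∑ t ∈ Finset.range l, (1 - η * μ) ^ (l - 1 - t) • X ω t) :
    (1 / (n : ℝ) ^ l) * ∑ ω : Fin l → Fin n, ‖X ω l - xstar‖ ^ 2 ≤
      (1 - η * μ) ^ l * ‖x0 - xstar‖ ^ 2
        - 2 * η * (1 - 2 * L * η) * S *
            ((1 / (n : ℝ) ^ l) * ∑ ω : Fin l → Fin n, (F (xt ω) - F xstar))
        + 2 * η ^ 2 * S * ((1 / (n : ℝ)) * ∑ i, ‖α i - g i xstar‖ ^ 2) := by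
  set q := 1 - η * μ with hq
  have hq0 : 0 ≤ q := by linarith
  set A := (1 / (n : ℝ)) * ∑ i, ‖α i - g i xstar‖ ^ 2 with hA
  have hn0 : (0 : ℝ) < n := by positivity
  have hc : 0 ≤ 1 - 2 * L * η := by
    rw [le_div_iff₀ (by positivity)] at hηL
    linarith
  have hS' : ∑ t ∈ Finset.range l, q ^ (l - 1 - t) = S := by
    rw [hS, Finset.sum_range_reflect (fun t => q ^ t)]
  have hSpos : 0 < S := by
    rw [hS]
    refine Finset.sum_pos' (fun t _ => pow_nonneg hq0 t) ⟨0, by simpa using hl, by simp⟩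
  have hadapt : ∀ (t : ℕ), t ≤ l → ∀ ω ω' : Fin l → Fin n,
      (∀ s : Fin l, s.val < t → ω s = ω' s) → X ω t = X ω' t := by
    intro t
    induction t with
    | zero => intro _ ω ω' _; rw [hX0, hX0]
    | succ t ih =>
      intro ht ω ω' h
      have e := ih (by omega) ω ω' fun s hs => h s (by omega)
      have h1 := hXstep ω ⟨t, ht⟩
      have h2 := hXstep ω' ⟨t, ht⟩
      simp only at h1 h2
      rw [h1, h2, e, h ⟨t, ht⟩ (Nat.lt_succ_self t)]
  have hrec : ∀ t < l, ∑ ω, ‖X ω (t + 1) - xstar‖ ^ 2 ≤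
      q * ∑ ω, ‖X ω t - xstar‖ ^ 2
        + (- (2 * η * (1 - 2 * L * η)) * ∑ ω, (F (X ω t) - F xstar)
            + (n : ℝ) ^ l * (2 * η ^ 2 * A)) := by
    intro t ht
    have h := Fintype.card_mul_sum_apply_eq (⟨t, ht⟩ : Fin l)
      (fun (ω : Fin l → Fin n) i => ‖X ω t - η • (g i (X ω t) - α i + αbar) - xstar‖ ^ 2)
      (fun ω i j => by
        rw [hadapt t ht.le (Function.update ω ⟨t, ht⟩ j) ω fun s hs =>
          Function.update_of_ne (fun e => by simp [e] at hs) _ _])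
    have h2 := Finset.sum_le_sum fun ω (_ : ω ∈ (Finset.univ : Finset (Fin l → Fin n))) =>
      sum_norm_svrg_step_sq_le hn hL hgrad hconv hsmooth hF hG hstrong hmin hαbar hη (X ω t)
    rw [← h, ← Finset.mul_sum, Fintype.card_fin] at h2
    have h3 := le_of_mul_le_mul_left h2 hn0
    rw [Finset.sum_add_distrib, Finset.sum_sub_distrib, ← Finset.mul_sum, ← Finset.mul_sum,
      Finset.sum_const, Finset.card_univ, Fintype.card_fun, Fintype.card_fin, Fintype.card_fin,
      nsmul_eq_mul, Nat.cast_pow] at h3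
    have h4 : ∀ ω, X ω (t + 1) =
        X ω t - η • (g (ω ⟨t, ht⟩) (X ω t) - α (ω ⟨t, ht⟩) + αbar) := fun ω => hXstep ω ⟨t, ht⟩
    simp only [h4]
    linarith
  have hFconv : ConvexOn ℝ Set.univ F := by
    refine ⟨convex_univ, fun x _ y _ a b ha hb hab => ?_⟩
    rw [hF, hF x, hF y, smul_eq_mul, smul_eq_mul, mul_left_comm a, mul_left_comm b, ← mul_add,
      Finset.mul_sum _ _ a, Finset.mul_sum _ _ b, ← Finset.sum_add_distrib]
    exact mul_le_mul_of_nonneg_left (Finset.sum_le_sum fun i _ =>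
      (hconv i).2 (Set.mem_univ x) (Set.mem_univ y) ha hb hab) (by positivity)
  have hjensen : ∀ ω, S * (F (xt ω) - F xstar) ≤
      ∑ t ∈ Finset.range l, q ^ (l - 1 - t) * (F (X ω t) - F xstar) := by
    intro ω
    have h := hFconv.map_centerMass_le (t := Finset.range l) (w := fun t => q ^ (l - 1 - t))
      (p := X ω) (fun t _ => pow_nonneg hq0 _) (by rwa [hS']) (fun t _ => Set.mem_univ _)
    rw [Finset.centerMass, Finset.centerMass, hS', ← one_div, ← hxt, smul_eq_mul, one_div_mul_eq_div,
      le_div_iff₀ hSpos] at h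
    simp only [Function.comp_apply, smul_eq_mul] at h
    simp only [mul_sub, Finset.sum_sub_distrib, ← Finset.sum_mul, hS']
    linarith
  have hun := le_pow_mul_add_sum_of_recurrence hq0
    (u := fun t => ∑ ω, ‖X ω t - xstar‖ ^ 2)
    (b := fun t => - (2 * η * (1 - 2 * L * η)) * ∑ ω, (F (X ω t) - F xstar)
      + (n : ℝ) ^ l * (2 * η ^ 2 * A)) hrec
  have hN : (0 : ℝ) < (n : ℝ) ^ l := by positivity
  have hsumJ := Finset.sum_le_sum fun ω (_ : ω ∈ (Finset.univ : Finset (Fin l → Fin n))) => hjensen ω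
  rw [← Finset.mul_sum, Finset.sum_comm] at hsumJ
  simp only [← Finset.mul_sum] at hsumJ
  have hstart : ∑ ω : Fin l → Fin n, ‖X ω 0 - xstar‖ ^ 2 = (n : ℝ) ^ l * ‖x0 - xstar‖ ^ 2 := by
    simp [hX0]
  have hsplit : ∑ t ∈ Finset.range l, q ^ (l - 1 - t) *
        (- (2 * η * (1 - 2 * L * η)) * ∑ ω, (F (X ω t) - F xstar)
            + (n : ℝ) ^ l * (2 * η ^ 2 * A)) =
      - (2 * η * (1 - 2 * L * η)) *
          ∑ t ∈ Finset.range l, q ^ (l - 1 - t) * ∑ ω, (F (X ω t) - F xstar)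
        + S * ((n : ℝ) ^ l * (2 * η ^ 2 * A)) := by
    rw [← hS', Finset.mul_sum, Finset.sum_mul, ← Finset.sum_add_distrib]
    exact Finset.sum_congr rfl fun t _ => by ring
  rw [hstart, hsplit] at hun
  have hJ := mul_le_mul_of_nonneg_left hsumJ (show 0 ≤ 2 * η * (1 - 2 * L * η) by positivity)
  rw [one_div_mul_eq_div, one_div_mul_eq_div, div_le_iff₀ hN]
  have hfin : (q ^ l * ‖x0 - xstar‖ ^ 2
      - 2 * η * (1 - 2 * L * η) * S * ((∑ ω, (F (xt ω) - F xstar)) / (n : ℝ) ^ l)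
      + 2 * η ^ 2 * S * A) * (n : ℝ) ^ l =
      q ^ l * ((n : ℝ) ^ l * ‖x0 - xstar‖ ^ 2)
      - 2 * η * (1 - 2 * L * η) * (S * ∑ ω, (F (xt ω) - F xstar))
      + S * ((n : ℝ) ^ l * (2 * η ^ 2 * A)) := by
    field_simp
  rw [hfin]
  linarith
end

section
/- (Lemma 6, in tuple-average form.) Let ℓ ≤ n and γ > 0. With the non-convex inner-loop process below, let x̃(ω) = (1/ℓ)·Σ_{t=0}^{ℓ−1} x_t(ω). Then the average, over ω uniform in {1,…,n}^ℓ and over an independent uniformly random ℓ-element subset Φ ⊆ {1,…,n}, of (1/n)·Σ_{i=1}^n ‖x_ℓ(ω) − θ_i^{new}(ω,Φ)‖², where θ_i^{new}(ω,Φ) = x̃(ω) if i ∈ Φ and θ_i^{new}(ω,Φ) = θ_i otherwise — equivalently E_ω[(ℓ/n)·‖x_ℓ(ω) − x̃(ω)‖² + (1 − ℓ/n)·(1/n)·Σ_{i=1}^n ‖x_ℓ(ω) − θ_i‖²] — is at most η²·ℓ·E_ω Σ_{t=0}^{ℓ−1} ‖v_t(ω)‖² + (1 − ℓ/n)·(η/γ)·E_ω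 Σ_{t=0}^{ℓ−1} ‖∇f(x_t(ω))‖² + (1 + γηℓ)·(1 − ℓ/n)·(1/n)·Σ_{i=1}^n ‖x_0 − θ_i‖². -/
/-- Averaging a coordinate: if `φ ω` does not depend on the coordinate `ω t`, then replacing the
coordinate `ω t` by an independent copy does not change the sum over all tuples. -/
theorem card_smul_sum_apply_eq_sum_sum {ι κ M : Type*} [Fintype ι] [DecidableEq ι] [Fintype κ]
    [AddCommMonoid M] (t : ι) (φ : (ι → κ) → κ → M)
    (hφ : ∀ ω j, φ (Function.update ω t j) = φ ω) :
    Fintype.card κ • ∑ ω : ι → κ, φ ω (ω t) = ∑ ω : ι → κ, ∑ j, φ ω j := by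
  have hinv : Function.Involutive
      (fun p : (ι → κ) × κ => (Function.update p.1 t p.2, p.1 t)) := by
    rintro ⟨ω, j⟩
    simp
  calc Fintype.card κ • ∑ ω : ι → κ, φ ω (ω t)
      = ∑ p : (ι → κ) × κ, φ p.1 (p.1 t) := by
        simp [Fintype.sum_prod_type, Finset.smul_sum]
    _ = ∑ p : (ι → κ) × κ, φ p.1 p.2 :=
        Fintype.sum_equiv hinv.toPerm _ _ fun p => by
          simp [Function.Involutive.coe_toPerm, hφ]
    _ = ∑ ω : ι → κ, ∑ j, φ ω j := Fintype.sum_prod_type _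

/-- The sum over all `l`-subsets `Φ` of a total that takes the value `a` on `Φ` and `b i` off it. -/
theorem sum_powersetCard_sum_ite {n l : ℕ} (hn : 0 < n) (hln : l ≤ n) (a : ℝ) (b : Fin n → ℝ) :
    ∑ Φ ∈ Finset.powersetCard l (Finset.univ : Finset (Fin n)),
        ∑ i, (if i ∈ Φ then a else b i) =
      (n.choose l : ℝ) * (l * a + (1 - (l : ℝ) / n) * ∑ i, b i) := by
  have hn' : (n : ℝ) ≠ 0 := by positivity
  have hcard (i : Fin n) :
      (((Finset.powersetCard l (Finset.univ : Finset (Fin n))).filter (i ∉ ·)).card : ℝ) =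
        (n.choose l : ℝ) * (1 - (l : ℝ) / n) := by
    have hset : (Finset.powersetCard l (Finset.univ : Finset (Fin n))).filter (i ∉ ·) =
        Finset.powersetCard l (Finset.univ.erase i) := by
      ext Φ
      simp [Finset.mem_powersetCard, Finset.subset_erase, and_comm]
    obtain ⟨m, rfl⟩ : ∃ m, n = m + 1 := ⟨n - 1, by omega⟩
    have h := Nat.choose_mul_succ_eq m l
    rw [hset, Finset.card_powersetCard, Finset.card_erase_of_mem (Finset.mem_univ i),
      Finset.card_univ, Fintype.card_fin, Nat.add_sub_cancel]
    have h' : (m.choose l : ℝ) * (m + 1 : ℕ) = ((m + 1).choose l : ℝ) * ((m + 1 : ℕ) - l) := by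
      rw [← Nat.cast_sub hln]
      exact_mod_cast h
    field_simp
    exact h'
  have hsplit (Φ : Finset (Fin n)) (hΦ : Φ ∈ Finset.powersetCard l Finset.univ) :
      ∑ i, (if i ∈ Φ then a else b i) = l * a + ∑ i, if i ∉ Φ then b i else 0 := by
    rw [← Finset.sum_filter, Finset.sum_ite, Finset.sum_const, Finset.filter_univ_mem,
      (Finset.mem_powersetCard.1 hΦ).2, nsmul_eq_mul]
  rw [Finset.sum_congr rfl hsplit, Finset.sum_add_distrib, Finset.sum_comm]
  simp only [← Finset.sum_filter, Finset.sum_const, nsmul_eq_mul, hcard, Finset.card_powersetCard,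
    Finset.card_univ, Fintype.card_fin, ← Finset.mul_sum]
  ring

/-- Cauchy–Schwarz for the norm of a sum of vectors. -/
theorem norm_sum_sq_le_card_mul_sum_norm_sq {E ι : Type*}
    [SeminormedAddCommGroup E] (s : Finset ι) (v : ι → E) :
    ‖∑ i ∈ s, v i‖ ^ 2 ≤ s.card * ∑ i ∈ s, ‖v i‖ ^ 2 :=
  (pow_le_pow_left₀ (norm_nonneg _) (norm_sum_le s v) 2).trans sq_sum_le_card_mul_sum_sq

section Trajectory

variable {E : Type*} [NormedAddCommGroup E] [NormedSpace ℝ E]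

theorem sub_eq_neg_smul_sum_Ico_of_step {l : ℕ} {η : ℝ} {x v : ℕ → E}
    (hstep : ∀ t < l, x (t + 1) = x t - η • v t) {s : ℕ} (hs : s ≤ l) :
    x l - x s = -(η • ∑ t ∈ Finset.Ico s l, v t) := by
  rw [← Finset.sum_Ico_sub x hs, Finset.smul_sum, ← Finset.sum_neg_distrib]
  refine Finset.sum_congr rfl fun t ht => ?_
  rw [hstep t (Finset.mem_Ico.1 ht).2]
  abel

theorem norm_sub_sq_le_of_step {l : ℕ} {η : ℝ} {x v : ℕ → E}
    (hstep : ∀ t < l, x (t + 1) = x t - η • v t) {s : ℕ} (hs : s ≤ l) :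
    ‖x l - x s‖ ^ 2 ≤ η ^ 2 * l * ∑ t ∈ Finset.range l, ‖v t‖ ^ 2 := by
  rw [sub_eq_neg_smul_sum_Ico_of_step hstep hs, norm_neg, norm_smul, mul_pow, Real.norm_eq_abs,
    sq_abs, mul_assoc]
  gcongr
  refine (norm_sum_sq_le_card_mul_sum_norm_sq _ v).trans ?_
  rw [Nat.card_Ico]
  gcongr
  · omega
  · exact fun t ht => Finset.mem_range.2 (Finset.mem_Ico.1 ht).2

theorem norm_sub_average_sq_le_of_step {l : ℕ} (hl : 0 < l) {η : ℝ} {x v : ℕ → E}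
    (hstep : ∀ t < l, x (t + 1) = x t - η • v t) :
    ‖x l - (1 / (l : ℝ)) • ∑ t ∈ Finset.range l, x t‖ ^ 2 ≤
      η ^ 2 * l * ∑ t ∈ Finset.range l, ‖v t‖ ^ 2 := by
  have hl' : (0 : ℝ) < l := by exact_mod_cast hl
  have hdiff : x l - (1 / (l : ℝ)) • ∑ t ∈ Finset.range l, x t =
      (1 / (l : ℝ)) • ∑ t ∈ Finset.range l, (x l - x t) := by
    rw [Finset.sum_sub_distrib, Finset.sum_const, Finset.card_range, smul_sub,
      ← Nat.cast_smul_eq_nsmul ℝ, smul_smul, one_div_mul_cancel hl'.ne', one_smul]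
  set B := η ^ 2 * l * ∑ t ∈ Finset.range l, ‖v t‖ ^ 2
  have hsum : ∑ t ∈ Finset.range l, ‖x l - x t‖ ^ 2 ≤ l * B := by
    have h := Finset.sum_le_card_nsmul (Finset.range l) _ B fun t ht =>
      norm_sub_sq_le_of_step hstep (Finset.mem_range.1 ht).le
    simpa using h
  have hcs := norm_sum_sq_le_card_mul_sum_norm_sq (Finset.range l) (fun t => x l - x t)
  rw [Finset.card_range] at hcs
  rw [hdiff, norm_smul, mul_pow, Real.norm_eq_abs, sq_abs]
  calc (1 / (l : ℝ)) ^ 2 * ‖∑ t ∈ Finset.range l, (x l - x t)‖ ^ 2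
      ≤ (1 / (l : ℝ)) ^ 2 * (l * (l * B)) := by
        gcongr
        exact hcs.trans (by gcongr)
    _ = B := by field_simp

end Trajectory

section InnerProduct

variable {E : Type*} [NormedAddCommGroup E] [InnerProductSpace ℝ E]

theorem norm_sub_sq_le_of_step_add_inner {l : ℕ} {η : ℝ} {x v : ℕ → E}
    (hstep : ∀ t < l, x (t + 1) = x t - η • v t) (y : E) :
    ‖x l - y‖ ^ 2 ≤ η ^ 2 * l * ∑ t ∈ Finset.range l, ‖v t‖ ^ 2 + ‖x 0 - y‖ ^ 2
      - 2 * η * ∑ t ∈ Finset.range l, inner ℝ (v t) (x 0 - y) := by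
  have hsq := norm_add_sq_real (x l - x 0) (x 0 - y)
  rw [sub_add_sub_cancel] at hsq
  have hinner : inner ℝ (x l - x 0) (x 0 - y) =
      -(η * ∑ t ∈ Finset.range l, inner ℝ (v t) (x 0 - y)) := by
    rw [sub_eq_neg_smul_sum_Ico_of_step hstep (Nat.zero_le l), Nat.Ico_zero_eq_range,
      inner_neg_left, real_inner_smul_left, sum_inner]
  have hle := norm_sub_sq_le_of_step hstep (Nat.zero_le l)
  rw [hsq, hinner]
  linarith

/-- Young's inequality with parameter `γ`. -/
theorem neg_two_mul_inner_le {γ : ℝ} (hγ : 0 < γ) (u w : E) :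
    -(2 * inner ℝ u w) ≤ 1 / γ * ‖u‖ ^ 2 + γ * ‖w‖ ^ 2 := by
  have h := sq_nonneg ‖u + γ • w‖
  rw [norm_add_sq_real, norm_smul, real_inner_smul_right, mul_pow, Real.norm_eq_abs, sq_abs] at h
  have h' := div_nonneg h hγ.le
  have e : (‖u‖ ^ 2 + 2 * (γ * inner ℝ u w) + γ ^ 2 * ‖w‖ ^ 2) / γ =
      1 / γ * ‖u‖ ^ 2 + γ * ‖w‖ ^ 2 + 2 * inner ℝ u w := by
    field_simp
    ring
  linarith

end InnerProduct

/-- The iterates are adapted: `X ω s` depends on the coordinates of `ω` below `s` only. -/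
theorem iterate_update_eq {E κ : Type*} [AddCommGroup E] [Module ℝ E] {l : ℕ} {x0 : E} {η : ℝ}
    {w : κ → E → E} {X : (Fin l → κ) → ℕ → E} (hX0 : ∀ ω, X ω 0 = x0)
    (hXstep : ∀ ω (t : Fin l), X ω (t.val + 1) = X ω t.val - η • w (ω t) (X ω t.val))
    (ω : Fin l → κ) (t : Fin l) (j : κ) {s : ℕ} (hs : s ≤ t) :
    X (Function.update ω t j) s = X ω s := by
  induction s with
  | zero => rw [hX0, hX0]
  | succ s ih =>
    have hst : s < t := hs
    have hne : (⟨s, hst.trans t.isLt⟩ : Fin l) ≠ t := fun h => hst.ne (congrArg Fin.val h)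
    have h₁ := hXstep (Function.update ω t j) ⟨s, hst.trans t.isLt⟩
    have h₂ := hXstep ω ⟨s, hst.trans t.isLt⟩
    simp only [Function.update_of_ne hne, ih hst.le] at h₁ h₂
    rw [h₁, h₂]


/-- Lemma 6, in tuple-average form: expected value of the new distance term
`(1/n)·Σᵢ ‖x_ℓ(ω) − θᵢ^new(ω,Φ)‖²` after the block snapshot update, averaged over the
inner-loop tuple `ω` and an independent uniformly random `ℓ`-element subset `Φ`. -/
theorem kSVRG_nonconvex_H_recurrence {E : Type*} [NormedAddCommGroup E]
    [InnerProductSpace ℝ E] [CompleteSpace E]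
    (n l : ℕ) (hn : 0 < n) (hl : 0 < l) (hln : l ≤ n) (L : ℝ) (hL : 0 < L)
    (f : Fin n → E → ℝ) (g : Fin n → E → E)
    (hgrad : ∀ i x, HasGradientAt (f i) (g i x) x)
    (hsmooth : ∀ i x y, ‖g i x - g i y‖ ≤ L * ‖x - y‖)
    (F : E → ℝ) (hF : ∀ x, F x = (1 / (n : ℝ)) * ∑ i, f i x)
    (G : E → E) (hG : ∀ x, G x = (1 / (n : ℝ)) • ∑ i, g i x)
    (θ : Fin n → E) (αbar : E) (hαbar : αbar = (1 / (n : ℝ)) • ∑ j, g j (θ j))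
    (η : ℝ) (hη : 0 < η) (γ : ℝ) (hγ : 0 < γ) (x0 : E)
    (X V : (Fin l → Fin n) → ℕ → E)
    (hX0 : ∀ ω, X ω 0 = x0)
    (hV : ∀ ω (t : Fin l),
      V ω t.val = g (ω t) (X ω t.val) - g (ω t) (θ (ω t)) + αbar)
    (hXstep : ∀ ω (t : Fin l), X ω (t.val + 1) = X ω t.val - η • V ω t.val)
    (xt : (Fin l → Fin n) → E)
    (hxt : ∀ ω, xt ω = (1 / (l : ℝ)) • ∑ t ∈ Finset.range l, X ω t) :
    (1 / ((n : ℝ) ^ l * (n.choose l : ℝ))) *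
        ∑ ω : Fin l → Fin n,
          ∑ Φ ∈ Finset.powersetCard l (Finset.univ : Finset (Fin n)),
            ((1 / (n : ℝ)) * ∑ i,
              ‖X ω l - (if i ∈ Φ then xt ω else θ i)‖ ^ 2) ≤
      η ^ 2 * (l : ℝ) *
          ((1 / (n : ℝ) ^ l) *
            ∑ ω : Fin l → Fin n, ∑ t ∈ Finset.range l, ‖V ω t‖ ^ 2)
        + (1 - (l : ℝ) / (n : ℝ)) * (η / γ) *
            ((1 / (n : ℝ) ^ l) *
              ∑ ω : Fin l → Fin n, ∑ t ∈ Finset.range l, ‖G (X ω t)‖ ^ 2)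
        + (1 + γ * η * (l : ℝ)) * (1 - (l : ℝ) / (n : ℝ)) *
            ((1 / (n : ℝ)) * ∑ i, ‖x0 - θ i‖ ^ 2) := by
  have hn' : (0 : ℝ) < n := by exact_mod_cast hn
  have hstep (ω) : ∀ t < l, X ω (t + 1) = X ω t - η • V ω t := fun t ht => hXstep ω ⟨t, ht⟩
  have hunbiased (t : ℕ) (ht : t ∈ Finset.range l) : ∑ ω, V ω t = ∑ ω, G (X ω t) := by
    have hadapted := iterate_update_eq (w := fun i x => g i x - g i (θ i) + αbar) hX0
      fun ω t => by rw [hXstep, hV]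
    have h := card_smul_sum_apply_eq_sum_sum (⟨t, Finset.mem_range.1 ht⟩ : Fin l)
      (fun ω i => g i (X ω t) - g i (θ i) + αbar)
      fun ω j => by simp only [hadapted ω ⟨t, Finset.mem_range.1 ht⟩ j le_rfl]
    have hmean (x : E) : ∑ i, (g i x - g i (θ i) + αbar) = (n : ℝ) • G x := by
      rw [Finset.sum_add_distrib, Finset.sum_sub_distrib, Finset.sum_const, Finset.card_univ,
        Fintype.card_fin, ← Nat.cast_smul_eq_nsmul ℝ, hαbar, hG, smul_smul, smul_smul,
        mul_one_div_cancel hn'.ne', one_smul, one_smul, sub_add_cancel]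
    simp only [hmean, Fintype.card_fin, ← Finset.smul_sum, ← Nat.cast_smul_eq_nsmul ℝ] at h
    rw [← smul_right_injective E hn'.ne' h]
    exact Finset.sum_congr rfl fun ω _ => hV ω ⟨t, Finset.mem_range.1 ht⟩
  set SV := ∑ ω : Fin l → Fin n, ∑ t ∈ Finset.range l, ‖V ω t‖ ^ 2
  set SG := ∑ ω : Fin l → Fin n, ∑ t ∈ Finset.range l, ‖G (X ω t)‖ ^ 2
  have hfar (y : E) : ∑ ω, ‖X ω l - y‖ ^ 2 ≤ η ^ 2 * l * SV + η / γ * SG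
      + (n : ℝ) ^ l * ((1 + γ * η * l) * ‖x0 - y‖ ^ 2) := by
    have hcross : -(2 * η * ∑ ω, ∑ t ∈ Finset.range l, inner ℝ (V ω t) (x0 - y)) ≤
        η / γ * SG + (n : ℝ) ^ l * (γ * η * l * ‖x0 - y‖ ^ 2) := by
      have hswap : ∑ ω, ∑ t ∈ Finset.range l, inner ℝ (V ω t) (x0 - y) =
          ∑ ω, ∑ t ∈ Finset.range l, inner ℝ (G (X ω t)) (x0 - y) := by
        rw [Finset.sum_comm, Finset.sum_comm (s := Finset.univ)]
        refine Finset.sum_congr rfl fun t ht => ?_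
        rw [← sum_inner, ← sum_inner, hunbiased t ht]
      have hyoung : ∑ ω, ∑ t ∈ Finset.range l, -(2 * inner ℝ (G (X ω t)) (x0 - y)) ≤
          ∑ ω, ∑ t ∈ Finset.range l, (1 / γ * ‖G (X ω t)‖ ^ 2 + γ * ‖x0 - y‖ ^ 2) :=
        Finset.sum_le_sum fun ω _ => Finset.sum_le_sum fun t _ => neg_two_mul_inner_le hγ _ _
      simp only [Finset.sum_neg_distrib, Finset.sum_add_distrib, ← Finset.mul_sum,
        Finset.sum_const, Finset.card_univ, Finset.card_range, Fintype.card_fun, Fintype.card_fin,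
        nsmul_eq_mul, Nat.cast_pow] at hyoung
      rw [hswap]
      calc _ = η * -(2 * ∑ ω, ∑ t ∈ Finset.range l, inner ℝ (G (X ω t)) (x0 - y)) := by ring
        _ ≤ _ := mul_le_mul_of_nonneg_left hyoung hη.le
        _ = _ := by ring
    have h := Finset.sum_le_sum fun ω (_ : ω ∈ Finset.univ) =>
      norm_sub_sq_le_of_step_add_inner (hstep ω) y
    simp only [hX0, Finset.sum_sub_distrib, Finset.sum_add_distrib, ← Finset.mul_sum,
      Finset.sum_const, Finset.card_univ, Fintype.card_fun, Fintype.card_fin, nsmul_eq_mul,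
      Nat.cast_pow] at h
    linarith
  have hnear : ∑ ω, ‖X ω l - xt ω‖ ^ 2 ≤ η ^ 2 * l * SV := by
    rw [Finset.mul_sum]
    refine Finset.sum_le_sum fun ω _ => ?_
    rw [hxt]
    exact norm_sub_average_sq_le_of_step hl (hstep ω)
  have hsubsets (ω : Fin l → Fin n) :
      ∑ Φ ∈ Finset.powersetCard l (Finset.univ : Finset (Fin n)),
        ((1 / (n : ℝ)) * ∑ i, ‖X ω l - (if i ∈ Φ then xt ω else θ i)‖ ^ 2) =
      (n.choose l : ℝ) * ((l : ℝ) / n * ‖X ω l - xt ω‖ ^ 2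
        + (1 - (l : ℝ) / n) * (1 / n) * ∑ i, ‖X ω l - θ i‖ ^ 2) := by
    have hite (Φ : Finset (Fin n)) (i : Fin n) :
        ‖X ω l - (if i ∈ Φ then xt ω else θ i)‖ ^ 2 =
          if i ∈ Φ then ‖X ω l - xt ω‖ ^ 2 else ‖X ω l - θ i‖ ^ 2 := by
      split_ifs <;> rfl
    simp only [hite]
    rw [← Finset.mul_sum, sum_powersetCard_sum_ite hn hln]
    ring
  have hchoose : (0 : ℝ) < n.choose l := by exact_mod_cast Nat.choose_pos hln
  have hfrac : (l : ℝ) / n ≤ 1 := (div_le_one hn').2 (by exact_mod_cast hln)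
  have hfar_sum : ∑ ω, ∑ i, ‖X ω l - θ i‖ ^ 2 ≤ n * (η ^ 2 * l * SV + η / γ * SG)
      + (n : ℝ) ^ l * ((1 + γ * η * l) * ∑ i, ‖x0 - θ i‖ ^ 2) := by
    have h := Finset.sum_le_sum fun i (_ : i ∈ Finset.univ) => hfar (θ i)
    rw [Finset.sum_comm, Finset.sum_add_distrib, Finset.sum_const, Finset.card_univ,
      Fintype.card_fin, nsmul_eq_mul, ← Finset.mul_sum, ← Finset.mul_sum] at h
    exact h
  simp only [hsubsets]
  rw [← Finset.mul_sum, Finset.sum_add_distrib, ← Finset.mul_sum, ← Finset.mul_sum]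
  calc _ = 1 / (n : ℝ) ^ l * ((l : ℝ) / n * ∑ ω, ‖X ω l - xt ω‖ ^ 2
        + (1 - (l : ℝ) / n) * (1 / n) * ∑ ω, ∑ i, ‖X ω l - θ i‖ ^ 2) := by
        field_simp
    _ ≤ 1 / (n : ℝ) ^ l * ((l : ℝ) / n * (η ^ 2 * l * SV)
        + (1 - (l : ℝ) / n) * (1 / n) * (n * (η ^ 2 * l * SV + η / γ * SG)
          + (n : ℝ) ^ l * ((1 + γ * η * l) * ∑ i, ‖x0 - θ i‖ ^ 2))) := by
        have := sub_nonneg.2 hfrac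
        gcongr
    _ = _ := by
        field_simp
        ring
end
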